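/- arXiv:1602.00724 — 6 statements merged into one kernel-verified Lean document; each statement's English description precedes it below -/
import Mathlib

section
/- Let Y be a random variable following the Poisson distribution with mean m > 0. Then for every u > 0, the probability that Y − m > u is at most exp( −(u/4) · log(1 + u/(2m)) ). In particular, if Y has mean nλ with λ > 0 and n ≥ 1, then P{ Y/n − λ > t } ≤ exp( −(n t/4) · log(1 + t/(2λ)) ) for every t > 0. -/
open MeasureTheory Real

/-- The moment generating function of a Poisson variable, as a Lebesgue integral. -/
theorem lintegral_exp_mul_of_poisson {Ω : Type*} [MeasurableSpace Ω] (μ : Measure Ω)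
    (m : ℝ) (hm : 0 < m) (Y : Ω → ℕ) (hYmeas : Measurable Y)
    (hY : ∀ y : ℕ, μ {ω | Y ω = y} = ENNReal.ofReal (Real.exp (-m) * m ^ y / (Nat.factorial y)))
    (θ : ℝ) :
    ∫⁻ ω, ENNReal.ofReal (Real.exp (θ * Y ω)) ∂μ
      = ENNReal.ofReal (Real.exp (m * (Real.exp θ - 1))) := by
  have hmap : ∫⁻ ω, ENNReal.ofReal (Real.exp (θ * Y ω)) ∂μ
      = ∫⁻ y : ℕ, ENNReal.ofReal (Real.exp (θ * y)) ∂(μ.map Y) :=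
    (lintegral_map (f := fun y : ℕ => ENNReal.ofReal (Real.exp (θ * y)))
      (measurable_of_countable _) hYmeas).symm
  have hterm (y : ℕ) : ENNReal.ofReal (Real.exp (θ * y)) * (μ.map Y) {y}
      = ENNReal.ofReal (Real.exp (-m) * ((m * Real.exp θ) ^ y / (Nat.factorial y))) := by
    have hpre : Y ⁻¹' {y} = {ω | Y ω = y} := rfl
    rw [Measure.map_apply hYmeas (measurableSet_singleton y), hpre, hY,
      ← ENNReal.ofReal_mul (Real.exp_pos _).le, mul_comm θ, Real.exp_nat_mul, mul_pow]
    congr 1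
    ring
  have hsum : HasSum (fun y : ℕ => Real.exp (-m) * ((m * Real.exp θ) ^ y / (Nat.factorial y)))
      (Real.exp (m * (Real.exp θ - 1))) := by
    have h := (NormedSpace.expSeries_div_hasSum_exp (m * Real.exp θ)).mul_left (Real.exp (-m))
    rw [← Real.exp_eq_exp_ℝ, ← Real.exp_add] at h
    rwa [show m * (Real.exp θ - 1) = -m + m * Real.exp θ by ring]
  rw [hmap, lintegral_countable', ← hsum.tsum_eq,
    ENNReal.ofReal_tsum_of_nonneg (fun y => by positivity) hsum.summable]
  exact tsum_congr hterm

/-- The Chernoff bound for the upper tail of a Poisson variable. -/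
theorem poisson_chernoff_bound {Ω : Type*} [MeasurableSpace Ω] (μ : Measure Ω)
    (m : ℝ) (hm : 0 < m) (Y : Ω → ℕ) (hYmeas : Measurable Y)
    (hY : ∀ y : ℕ, μ {ω | Y ω = y} = ENNReal.ofReal (Real.exp (-m) * m ^ y / (Nat.factorial y)))
    (θ : ℝ) (hθ : 0 ≤ θ) (u : ℝ) :
    (μ {ω | (Y ω : ℝ) - m > u}).toReal
      ≤ Real.exp (m * (Real.exp θ - 1) - θ * (m + u)) := by
  have hsub : {ω | (Y ω : ℝ) - m > u}
      ⊆ {ω | ENNReal.ofReal (Real.exp (θ * (m + u))) ≤ ENNReal.ofReal (Real.exp (θ * Y ω))} := by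
    intro ω hω
    have h : m + u ≤ Y ω := by
      have : (Y ω : ℝ) - m > u := hω
      linarith
    exact ENNReal.ofReal_le_ofReal (Real.exp_le_exp.2 (mul_le_mul_of_nonneg_left h hθ))
  have hmarkov := meas_ge_le_lintegral_div (μ := μ)
    (f := fun ω => ENNReal.ofReal (Real.exp (θ * Y ω)))
    ((measurable_of_countable
      (fun y : ℕ => ENNReal.ofReal (Real.exp (θ * y)))).comp hYmeas).aemeasurable
    (ENNReal.ofReal_pos.2 (Real.exp_pos (θ * (m + u)))).ne' ENNReal.ofReal_ne_top
  rw [lintegral_exp_mul_of_poisson μ m hm Y hYmeas hY θ,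
    ← ENNReal.ofReal_div_of_pos (Real.exp_pos _), ← Real.exp_sub] at hmarkov
  exact ENNReal.toReal_le_of_le_ofReal (Real.exp_pos _).le ((measure_mono hsub).trans hmarkov)

/-- Tail bound for a Poisson random variable: if `Y` is Poisson with mean `m > 0`, then for
every `u > 0`, `P{Y - m > u} ≤ exp(-(u/4) log(1 + u/(2m)))`; in particular, if the mean is
`n * λ`, then `P{Y/n - λ > t} ≤ exp(-(n t/4) log(1 + t/(2λ)))` for every `t > 0`. -/
theorem poisson_tail_bound {Ω : Type*} [MeasurableSpace Ω] (μ : Measure Ω)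
    [IsProbabilityMeasure μ] (m : ℝ) (hm : 0 < m) (Y : Ω → ℕ) (hYmeas : Measurable Y)
    (hY : ∀ y : ℕ, μ {ω | Y ω = y} = ENNReal.ofReal (Real.exp (-m) * m ^ y / (Nat.factorial y))) :
    (∀ u : ℝ, 0 < u →
      (μ {ω | (Y ω : ℝ) - m > u}).toReal ≤ Real.exp (-(u / 4) * Real.log (1 + u / (2 * m)))) ∧
    (∀ (n : ℕ) (lam : ℝ), 1 ≤ n → 0 < lam → m = n * lam →
      ∀ t : ℝ, 0 < t →
        (μ {ω | (Y ω : ℝ) / n - lam > t}).toReal ≤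
          Real.exp (-(n * t / 4) * Real.log (1 + t / (2 * lam)))) := by
  have tail : ∀ u : ℝ, 0 < u →
      (μ {ω | (Y ω : ℝ) - m > u}).toReal
        ≤ Real.exp (-(u / 4) * Real.log (1 + u / (2 * m))) := by
    intro u hu
    have hr : 0 < 1 + u / (2 * m) := by positivity
    have hlog : u / (2 * m + u) ≤ Real.log (1 + u / (2 * m)) := by
      refine le_trans (le_of_eq ?_) (Real.one_sub_inv_le_log_of_pos hr)
      field_simp
      ring
    have hθ : 0 ≤ Real.log (1 + u / (2 * m)) := le_trans (by positivity) hlog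
    refine (poisson_chernoff_bound μ m hm Y hYmeas hY _ hθ u).trans (Real.exp_le_exp.2 ?_)
    have hexp : m * (Real.exp (Real.log (1 + u / (2 * m))) - 1) = u / 2 := by
      rw [Real.exp_log hr]
      field_simp
      ring
    rw [hexp]
    rw [div_le_iff₀ (by positivity)] at hlog
    nlinarith [mul_nonneg hθ hu.le]
  refine ⟨tail, fun n lam hn hlam hmn t ht => ?_⟩
  have hn0 : (0 : ℝ) < n := by exact_mod_cast hn
  have hset : {ω | (Y ω : ℝ) / n - lam > t} = {ω | (Y ω : ℝ) - m > n * t} := by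
    ext ω
    simp only [Set.mem_ofPred_eq, gt_iff_lt, lt_sub_iff_add_lt, lt_div_iff₀ hn0, hmn]
    ring_nf
  have hratio : n * t / (2 * m) = t / (2 * lam) := by
    rw [hmn]
    field_simp
  rw [hset, ← hratio]
  exact tail (n * t) (by positivity)
end

section
/- Fix t ≥ 0 and an index k ∈ {1, …, n} with η_k ≥ 1. Then C_{t+1} ≤ C_t / (1 − τ_t) − ξ_k, where ξ_k := τ_t · Tr(Φ_k V_t) / ( (1 − τ_t) · Tr(Φ_k X_t) · Tr(Φ_k X_{t+1}) ). -/
noncomputable section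

/-- The spectral norm (largest singular value) of a real square matrix. -/
def specNorm {p : ℕ} (M : Matrix (Fin p) (Fin p) ℝ) : ℝ :=
  ‖(Matrix.toEuclideanCLM (𝕜 := ℝ) M :
      EuclideanSpace ℝ (Fin p) →L[ℝ] EuclideanSpace ℝ (Fin p))‖

open scoped MatrixOrder in
/-- The trace of a product of two real positive semidefinite matrices is nonnegative. -/
theorem Matrix.PosSemidef.trace_mul_nonneg {m : Type*} [Fintype m] {A B : Matrix m m ℝ}
    (hA : A.PosSemidef) (hB : B.PosSemidef) : 0 ≤ (A * B).trace := by
  classical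
  obtain ⟨M, rfl⟩ := CStarAlgebra.nonneg_iff_eq_star_mul_self.mp hB.nonneg
  rw [Matrix.star_eq_conjTranspose]
  rw [← Matrix.mul_assoc, Matrix.trace_mul_comm, ← Matrix.mul_assoc]
  exact (hA.mul_mul_conjTranspose_same M).trace_nonneg

theorem inv_convexCombo_eq {a v s : ℝ} (ha : 0 < a) (hv : 0 ≤ v) (hs : 0 ≤ s) (hs1 : s < 1) :
    ((1 - s) * a + s * v)⁻¹ =
      a⁻¹ / (1 - s) - s * v / ((1 - s) * a * ((1 - s) * a + s * v)) := by
  have h1 : 0 < 1 - s := sub_pos.mpr hs1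
  have hb : 0 < (1 - s) * a + s * v := by positivity
  field_simp
  ring

/-- Sharper per-step bound: for any index `k` with `η_k ≥ 1`,
`C_{t+1} ≤ C_t/(1-τ_t) - ξ_k` with
`ξ_k = τ_t Tr(Φ_k V_t) / ((1-τ_t) Tr(Φ_k X_t) Tr(Φ_k X_{t+1}))`. -/
theorem frankWolfe_better_bound
    (p n : ℕ) (hp : 1 ≤ p) (hn : 1 ≤ n) (c : ℝ) (hc : 0 < c)
    (Ψ : Matrix (Fin p) (Fin p) ℝ) (η : Fin n → ℕ)
    (Φ : Fin n → Matrix (Fin p) (Fin p) ℝ) (hΦ : ∀ i, (Φ i).PosSemidef)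
    (α : ℕ → ℝ) (hα : ∀ t, 0 ≤ α t) (hα0 : 0 < α 0)
    (S : ℕ → ℝ) (hS : ∀ t, S t = ∑ k ∈ Finset.range (t + 1), α k)
    (τ : ℕ → ℝ) (hτ : ∀ t, τ t = α (t + 1) / S (t + 1))
    (hτ01 : ∀ t, 0 < τ t ∧ τ t < 1)
    (G : Matrix (Fin p) (Fin p) ℝ → Matrix (Fin p) (Fin p) ℝ)
    (hG : ∀ Y, G Y = Ψ - ∑ i, ((η i : ℝ) / (((Φ i) * Y).trace)) • Φ i)
    (X V : ℕ → Matrix (Fin p) (Fin p) ℝ)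
    (hX0 : (X 0).PosSemidef ∧ (X 0).trace ≤ c)
    (hX0pos : ∀ i, 0 < ((Φ i) * (X 0)).trace)
    (hV : ∀ t, (V t).PosSemidef ∧ (V t).trace ≤ c)
    (hVmin : ∀ (t : ℕ) (W : Matrix (Fin p) (Fin p) ℝ), W.PosSemidef → W.trace ≤ c →
      ((G (X t)) * (V t)).trace ≤ ((G (X t)) * W).trace)
    (hXsucc : ∀ t, X (t + 1) = (1 - τ t) • X t + τ t • V t)
    (C : ℕ → ℝ) (hC : ∀ t, C t = ∑ i, (η i : ℝ) / (((Φ i) * (X t)).trace))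
    (t : ℕ) (k : Fin n) (hk : 1 ≤ η k) :
    C (t + 1) ≤ C t / (1 - τ t) -
      τ t * ((Φ k) * (V t)).trace /
        ((1 - τ t) * ((Φ k) * (X t)).trace * ((Φ k) * (X (t + 1))).trace) := by
  have hv : ∀ i s, 0 ≤ (Φ i * V s).trace := fun i s => (hΦ i).trace_mul_nonneg (hV s).1
  have hstep : ∀ i s, (Φ i * X (s + 1)).trace =
      (1 - τ s) * (Φ i * X s).trace + τ s * (Φ i * V s).trace := by
    intro i s
    simp [hXsucc, Matrix.mul_add]
  have hpos : ∀ i s, 0 < (Φ i * X s).trace := by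
    intro i s
    induction s with
    | zero => exact hX0pos i
    | succ s ih =>
      rw [hstep]
      have := mul_pos (sub_pos.mpr (hτ01 s).2) ih
      have := mul_nonneg (hτ01 s).1.le (hv i s)
      linarith
  have h1 : 0 < 1 - τ t := sub_pos.mpr (hτ01 t).2
  let ξ : Fin n → ℝ := fun i => τ t * (Φ i * V t).trace /
    ((1 - τ t) * (Φ i * X t).trace * (Φ i * X (t + 1)).trace)
  have hξ : ∀ i, 0 ≤ ξ i := fun i =>
    div_nonneg (mul_nonneg (hτ01 t).1.le (hv i t))
      (mul_pos (mul_pos h1 (hpos i t)) (hpos i (t + 1))).le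
  have hterm : ∀ i, (η i : ℝ) / (Φ i * X (t + 1)).trace =
      (η i : ℝ) / (Φ i * X t).trace / (1 - τ t) - η i * ξ i := by
    intro i
    have h := inv_convexCombo_eq (hpos i t) (hv i t) (hτ01 t).1.le (hτ01 t).2
    rw [← hstep] at h
    rw [div_eq_mul_inv, h]
    simp only [ξ]
    ring
  have hsum : ξ k ≤ ∑ i, η i * ξ i :=
    calc ξ k ≤ η k * ξ k := le_mul_of_one_le_left (hξ k) (by exact_mod_cast hk)
      _ ≤ ∑ i, η i * ξ i :=
        Finset.single_le_sum (f := fun i => (η i : ℝ) * ξ i)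
          (fun i _ => mul_nonneg (Nat.cast_nonneg _) (hξ i)) (Finset.mem_univ k)
  rw [hC, hC, Finset.sum_congr rfl fun i _ => hterm i, Finset.sum_sub_distrib, Finset.sum_div]
  exact sub_le_sub_left hsum _
end
end

section
/- Fix t ≥ 0 and suppose C_t > 2 d_Ψ d_𝒞 / μ_. Then there exists an index k ∈ {1, …, n} such that 1 / Tr(Φ_k X_t) ≥ μ_ C_t / (4 n μ̄ d_η) and Tr(Φ_k V_t) ≥ μ_ / 4. -/
noncomputable section

open Matrix MatrixOrder in
theorem trace_mul_le_specNorm_mul_trace {p : ℕ} (M : Matrix (Fin p) (Fin p) ℝ)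
    {Y : Matrix (Fin p) (Fin p) ℝ} (hY : Y.PosSemidef) :
    |(M * Y).trace| ≤ specNorm M * Y.trace := by
  obtain ⟨B, rfl⟩ := CStarAlgebra.nonneg_iff_eq_star_mul_self.mp hY.nonneg
  have quadratic_le (x : Fin p → ℝ) : |x ⬝ᵥ (M *ᵥ x)| ≤ specNorm M * (x ⬝ᵥ x) := by
    have h := abs_real_inner_le_norm (WithLp.toLp 2 x)
      (toEuclideanCLM (𝕜 := ℝ) M (WithLp.toLp 2 x))
    have h2 := (toEuclideanCLM (𝕜 := ℝ) M).le_opNorm (WithLp.toLp 2 x)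
    have h3 : ‖WithLp.toLp 2 x‖ * ‖WithLp.toLp 2 x‖ = x ⬝ᵥ x := by
      rw [← real_inner_self_eq_norm_mul_norm, EuclideanSpace.inner_toLp_toLp, star_trivial]
    rw [toEuclideanCLM_toLp, EuclideanSpace.inner_toLp_toLp, star_trivial,
      dotProduct_comm] at h
    rw [toEuclideanCLM_toLp] at h2
    calc _ ≤ _ := h
      _ ≤ ‖WithLp.toLp 2 x‖ * (specNorm M * ‖WithLp.toLp 2 x‖) := by
        gcongr
        exact h2
      _ = _ := by rw [← h3]; ring
  have h1 : (M * (star B * B)).trace = ∑ j, B j ⬝ᵥ (M *ᵥ B j) := by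
    rw [← Matrix.mul_assoc, Matrix.trace_mul_comm]
    simp only [trace, diag_apply, mul_apply, dotProduct, mulVec, star_apply, star_trivial]
  have h2 : (star B * B).trace = ∑ j, B j ⬝ᵥ B j := by
    rw [Matrix.trace_mul_comm]
    simp only [trace, diag_apply, mul_apply, dotProduct, star_apply, star_trivial]
  rw [h1, h2, Finset.mul_sum]
  exact (Finset.abs_sum_le_sum_abs _ _).trans (Finset.sum_le_sum fun j _ => quadratic_le (B j))

open scoped MatrixOrder in
theorem Matrix.PosSemidef.trace_mul_nonneg_s8 {p : ℕ} {A Y : Matrix (Fin p) (Fin p) ℝ}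
    (hA : A.PosSemidef) (hY : Y.PosSemidef) : 0 ≤ (A * Y).trace := by
  obtain ⟨B, rfl⟩ := CStarAlgebra.nonneg_iff_eq_star_mul_self.mp hY.nonneg
  rw [← Matrix.mul_assoc, Matrix.trace_mul_comm, ← Matrix.mul_assoc]
  exact (hA.mul_mul_conjTranspose_same B).trace_nonneg

/-- A weighted sum that is larger than half of `m` times the total weight has a term whose
value and whose weight are both large. -/
theorem exists_large_value_and_weight {n : ℕ} {η w v : Fin n → ℝ} {C m M d : ℝ}
    (hη : ∀ i, 0 ≤ η i) (hηd : ∀ i, η i ≤ d) (hw : ∀ i, 0 ≤ w i)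
    (hv : ∀ i, 0 ≤ v i) (hvM : ∀ i, v i ≤ M) (hn : 0 < n) (hM : 0 < M) (hd : 0 < d)
    (hm : 0 < m) (hC : C = ∑ i, η i * w i) (hlt : m * C / 2 < ∑ i, η i * w i * v i) :
    ∃ k, m * C / (4 * (n : ℝ) * M * d) ≤ w k ∧ m / 4 ≤ v k := by
  by_contra! hcon
  have hn' : (0 : ℝ) < n := by exact_mod_cast hn
  have hC0 : 0 ≤ C := hC ▸ Finset.sum_nonneg fun i _ => mul_nonneg (hη i) (hw i)
  have hterm (i : Fin n) : η i * w i * v i ≤ η i * w i * (m / 4) + m * C / (4 * n) := by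
    have hηw := mul_nonneg (hη i) (hw i)
    by_cases h : m * C / (4 * (n : ℝ) * M * d) ≤ w i
    · have := mul_le_mul_of_nonneg_left (hcon i h).le hηw
      have : 0 ≤ m * C / (4 * n) := by positivity
      linarith
    · have hprod : η i * w i * v i ≤ d * (m * C / (4 * (n : ℝ) * M * d)) * M :=
        mul_le_mul (mul_le_mul (hηd i) (not_le.mp h).le (hw i) hd.le) (hvM i) (hv i)
          (by positivity)
      have heq : d * (m * C / (4 * (n : ℝ) * M * d)) * M = m * C / (4 * n) := by
        field_simp
      have : 0 ≤ η i * w i * (m / 4) := by positivity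
      linarith
  have hsum := Finset.sum_le_sum fun i (_ : i ∈ Finset.univ) => hterm i
  rw [Finset.sum_add_distrib, ← Finset.sum_mul, ← hC, Finset.sum_const, Finset.card_univ,
    Fintype.card_fin, nsmul_eq_mul] at hsum
  have : (n : ℝ) * (m * C / (4 * n)) = m * C / 4 := by field_simp
  linarith

/-- If `C_t > 2 d_Ψ d_𝒞 / μ_`, then there is an index `k` with
`1/Tr(Φ_k X_t) ≥ μ_ C_t / (4 n μ̄ d_η)` and `Tr(Φ_k V_t) ≥ μ_/4`. -/
theorem frankWolfe_key_index
    (p n : ℕ) (hp : 1 ≤ p) (hn : 1 ≤ n) (c : ℝ) (hc : 0 < c)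
    (Ψ : Matrix (Fin p) (Fin p) ℝ) (η : Fin n → ℕ)
    (Φ : Fin n → Matrix (Fin p) (Fin p) ℝ) (hΦ : ∀ i, (Φ i).PosSemidef)
    (α : ℕ → ℝ) (hα : ∀ t, 0 ≤ α t) (hα0 : 0 < α 0)
    (S : ℕ → ℝ) (hS : ∀ t, S t = ∑ k ∈ Finset.range (t + 1), α k)
    (τ : ℕ → ℝ) (hτ : ∀ t, τ t = α (t + 1) / S (t + 1))
    (hτ01 : ∀ t, 0 < τ t ∧ τ t < 1)
    (G : Matrix (Fin p) (Fin p) ℝ → Matrix (Fin p) (Fin p) ℝ)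
    (hG : ∀ Y, G Y = Ψ - ∑ i, ((η i : ℝ) / (((Φ i) * Y).trace)) • Φ i)
    (X V : ℕ → Matrix (Fin p) (Fin p) ℝ)
    (hX0 : (X 0).PosSemidef ∧ (X 0).trace ≤ c)
    (hX0pos : ∀ i, 0 < ((Φ i) * (X 0)).trace)
    (hV : ∀ t, (V t).PosSemidef ∧ (V t).trace ≤ c)
    (hVmin : ∀ (t : ℕ) (W : Matrix (Fin p) (Fin p) ℝ), W.PosSemidef → W.trace ≤ c →
      ((G (X t)) * (V t)).trace ≤ ((G (X t)) * W).trace)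
    (hXsucc : ∀ t, X (t + 1) = (1 - τ t) • X t + τ t • V t)
    (C : ℕ → ℝ) (hC : ∀ t, C t = ∑ i, (η i : ℝ) / (((Φ i) * (X t)).trace))
    (dC dΦ dΨ dη μbar μlow : ℝ)
    (hdC : dC = 2 * c) (hdΦ : dΦ = ⨆ i, specNorm (Φ i)) (hdΨ : dΨ = specNorm Ψ)
    (hdη : dη = ⨆ i, (η i : ℝ))
    (hμbar : IsGreatest {v : ℝ | ∃ (i : Fin n) (Y : Matrix (Fin p) (Fin p) ℝ),
      Y.PosSemidef ∧ Y.trace ≤ c ∧ v = ((Φ i) * Y).trace} μbar)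
    (hμlow : μlow = ⨅ i, ((Φ i) * (X 0)).trace)
    (t : ℕ) (hCt : C t > 2 * dΨ * dC / μlow) :
    ∃ k : Fin n,
      μlow * C t / (4 * (n : ℝ) * μbar * dη) ≤ 1 / ((Φ k) * (X t)).trace ∧
      μlow / 4 ≤ ((Φ k) * (V t)).trace := by
  have : Nonempty (Fin n) := ⟨⟨0, hn⟩⟩
  have hXpos (s : ℕ) (i : Fin n) : 0 < ((Φ i) * (X s)).trace := by
    induction s with
    | zero => exact hX0pos i
    | succ s ih =>
      rw [hXsucc, Matrix.mul_add, Matrix.mul_smul, Matrix.mul_smul, Matrix.trace_add,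
        Matrix.trace_smul, Matrix.trace_smul, smul_eq_mul, smul_eq_mul]
      exact add_pos_of_pos_of_nonneg (mul_pos (sub_pos.mpr (hτ01 s).2) ih)
        (mul_nonneg (hτ01 s).1.le ((hΦ i).trace_mul_nonneg_s8 (hV s).1))
  have hμle (i : Fin n) : μlow ≤ ((Φ i) * (X 0)).trace :=
    hμlow ▸ ciInf_le (Set.finite_range _).bddBelow i
  have hμpos : 0 < μlow := by
    obtain ⟨i, hi⟩ := exists_eq_ciInf_of_finite (f := fun i => ((Φ i) * (X 0)).trace)
    rw [hμlow, ← hi]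
    exact hX0pos i
  have hdΨ0 : 0 ≤ dΨ := hdΨ ▸ norm_nonneg _
  have hCpos : 0 < C t := lt_of_le_of_lt (by rw [hdC]; positivity) hCt
  have hηd (i : Fin n) : (η i : ℝ) ≤ dη :=
    hdη ▸ le_ciSup (f := fun i => (η i : ℝ)) (Set.finite_range _).bddAbove i
  have hdηpos : 0 < dη := by
    by_contra! h
    have hη (i : Fin n) : (η i : ℝ) = 0 := le_antisymm ((hηd i).trans h) (Nat.cast_nonneg _)
    simp [hC, hη] at hCpos
  have hle_μbar (i : Fin n) {Y : Matrix (Fin p) (Fin p) ℝ} (hY : Y.PosSemidef)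
      (hYc : Y.trace ≤ c) : ((Φ i) * Y).trace ≤ μbar := hμbar.2 ⟨i, Y, hY, hYc, rfl⟩
  have hμbarpos : 0 < μbar :=
    (hX0pos ⟨0, hn⟩).trans_le (hle_μbar ⟨0, hn⟩ hX0.1 hX0.2)
  have htrace (Y : Matrix (Fin p) (Fin p) ℝ) : ((G (X t)) * Y).trace = (Ψ * Y).trace -
      ∑ i, (η i : ℝ) * (1 / ((Φ i) * (X t)).trace) * ((Φ i) * Y).trace := by
    simp [hG, Matrix.sub_mul, Finset.sum_mul, Matrix.trace_sum, div_eq_mul_inv]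
  have hCsum : C t = ∑ i, (η i : ℝ) * (1 / ((Φ i) * (X t)).trace) := by
    simp only [hC, mul_one_div]
  have hX0sum : C t * μlow ≤
      ∑ i, (η i : ℝ) * (1 / ((Φ i) * (X t)).trace) * ((Φ i) * (X 0)).trace := by
    rw [hCsum, Finset.sum_mul]
    exact Finset.sum_le_sum fun i _ => mul_le_mul_of_nonneg_left (hμle i)
      (mul_nonneg (Nat.cast_nonneg _) (one_div_pos.mpr (hXpos t i)).le)
  have hΨbound {Y : Matrix (Fin p) (Fin p) ℝ} (hY : Y.PosSemidef) (hYc : Y.trace ≤ c) :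
      |(Ψ * Y).trace| ≤ dΨ * c :=
    (trace_mul_le_specNorm_mul_trace Ψ hY).trans
      (hdΨ ▸ mul_le_mul_of_nonneg_left hYc hdΨ0)
  have hmin := hVmin t (X 0) hX0.1 hX0.2
  rw [htrace, htrace] at hmin
  have hΨX := (abs_le.mp (hΨbound hX0.1 hX0.2)).2
  have hΨV := (abs_le.mp (hΨbound (hV t).1 (hV t).2)).1
  rw [gt_iff_lt, div_lt_iff₀ hμpos, hdC] at hCt
  exact exists_large_value_and_weight (fun i => Nat.cast_nonneg (η i)) hηd
    (fun i => (one_div_pos.mpr (hXpos t i)).le)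
    (fun i => (hΦ i).trace_mul_nonneg_s8 (hV t).1) (fun i => hle_μbar i (hV t).1 (hV t).2)
    hn hμbarpos hdηpos hμpos hCsum (by linarith)
end
end

section
/- Fix t ≥ 0 and assume: (i) 1 − (4 n μ̄ d_η / μ_) τ_t > 0; (ii) C_t > 2 d_Ψ d_𝒞 / μ_; and (iii) C_t ≥ κ_t, where κ_t := 64 (1 − τ_t) n² μ̄² d_η² / ( μ_³ (1 − (4 n μ̄ d_η / μ_) τ_t) ). Then C_{t+1} ≤ C_t. -/
noncomputable section

/-- The trace of the product of two positive semidefinite matrices is nonnegative. -/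
theorem trace_mul_nonneg_of_posSemidef {p : ℕ} {A B : Matrix (Fin p) (Fin p) ℝ}
    (hA : A.PosSemidef) (hB : B.PosSemidef) : 0 ≤ (A * B).trace := by
  obtain ⟨D, rfl⟩ : ∃ D : Matrix (Fin p) (Fin p) ℝ, B = D.conjTranspose * D := by
    open scoped MatrixOrder in exact CStarAlgebra.nonneg_iff_eq_star_mul_self.mp hB.nonneg
  rw [← Matrix.mul_assoc, Matrix.trace_mul_comm, ← Matrix.mul_assoc]
  exact (hA.mul_mul_conjTranspose_same D).trace_nonneg

theorem abs_dotProduct_mulVec_le_specNorm {p : ℕ} (M : Matrix (Fin p) (Fin p) ℝ)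
    (b : Fin p → ℝ) : |b ⬝ᵥ M.mulVec b| ≤ specNorm M * (b ⬝ᵥ b) := by
  set y : EuclideanSpace ℝ (Fin p) := WithLp.toLp 2 b
  have hinner : b ⬝ᵥ M.mulVec b = inner ℝ y (Matrix.toEuclideanCLM (𝕜 := ℝ) M y) := by
    simp [y, EuclideanSpace.inner_eq_star_dotProduct, dotProduct_comm]
  have hself : b ⬝ᵥ b = ‖y‖ * ‖y‖ := by
    rw [← real_inner_self_eq_norm_mul_norm, EuclideanSpace.inner_eq_star_dotProduct]
    simp [y]
  rw [hinner, hself]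
  refine (abs_real_inner_le_norm _ _).trans ?_
  calc ‖y‖ * ‖Matrix.toEuclideanCLM (𝕜 := ℝ) M y‖ ≤ ‖y‖ * (specNorm M * ‖y‖) := by
        gcongr
        exact ContinuousLinearMap.le_opNorm _ _
    _ = specNorm M * (‖y‖ * ‖y‖) := by ring

/-- Duality of the spectral and nuclear norms, for a positive semidefinite second factor. -/
theorem abs_trace_mul_le_specNorm_mul_trace {p : ℕ} (M : Matrix (Fin p) (Fin p) ℝ)
    {W : Matrix (Fin p) (Fin p) ℝ} (hW : W.PosSemidef) :
    |(M * W).trace| ≤ specNorm M * W.trace := by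
  obtain ⟨D, rfl⟩ : ∃ D : Matrix (Fin p) (Fin p) ℝ, W = D.conjTranspose * D := by
    open scoped MatrixOrder in exact CStarAlgebra.nonneg_iff_eq_star_mul_self.mp hW.nonneg
  have hdot (N : Matrix (Fin p) (Fin p) ℝ) :
      (N * (D.conjTranspose * D)).trace = ∑ k, D k ⬝ᵥ N.mulVec (D k) := by
    rw [← Matrix.mul_assoc, Matrix.trace_mul_comm]
    rfl
  have htr : (D.conjTranspose * D).trace = ∑ k, D k ⬝ᵥ D k := by
    simpa using hdot 1
  rw [hdot, htr, Finset.mul_sum]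
  exact (Finset.abs_sum_le_sum_abs _ _).trans
    (Finset.sum_le_sum fun k _ => abs_dotProduct_mulVec_le_specNorm M (D k))

/-- A single dominant coordinate outweighs the growth of all others when averaging. -/
theorem sum_div_convexComb_le {n : ℕ} (η x v : Fin n → ℝ) (τ : ℝ) (j : Fin n)
    (hη : ∀ i, 0 ≤ η i) (hx : ∀ i, 0 < x i) (hv : ∀ i, 0 ≤ v i) (hτ : 0 < τ) (hτ1 : τ < 1)
    (hj : (∑ i, η i / x i) * ((1 - τ) * x j + τ * v j) ≤ η j / x j * v j) :
    ∑ i, η i / ((1 - τ) * x i + τ * v i) ≤ ∑ i, η i / x i := by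
  have h1τ : 0 < 1 - τ := sub_pos.mpr hτ1
  have hy : 0 < (1 - τ) * x j + τ * v j :=
    add_pos_of_pos_of_nonneg (mul_pos h1τ (hx j)) (mul_nonneg hτ.le (hv j))
  have hrest : ∑ i ∈ Finset.univ.erase j, η i / ((1 - τ) * x i + τ * v i) ≤
      (∑ i ∈ Finset.univ.erase j, η i / x i) / (1 - τ) := by
    rw [Finset.sum_div]
    refine Finset.sum_le_sum fun i _ => ?_
    rw [div_div, mul_comm (x i)]
    exact div_le_div_of_nonneg_left (hη i) (mul_pos h1τ (hx i))
      (le_add_of_nonneg_right (mul_nonneg hτ.le (hv i)))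
  rw [← Finset.add_sum_erase _ _ (Finset.mem_univ j)] at hj ⊢
  rw [← Finset.add_sum_erase _ (fun i => η i / x i) (Finset.mem_univ j)]
  set R := ∑ i ∈ Finset.univ.erase j, η i / x i
  set w := η j / x j with hw
  have hηj : η j = w * x j := by rw [hw, div_mul_cancel₀ _ (hx j).ne']
  have hmain : η j / ((1 - τ) * x j + τ * v j) + R / (1 - τ) ≤ w + R := by
    rw [div_add_div _ _ hy.ne' h1τ.ne', div_le_iff₀ (mul_pos hy h1τ), hηj]
    nlinarith [mul_le_mul_of_nonneg_left hj hτ.le]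
  linarith

/-- Quantitative criterion for a coordinate to dominate in `sum_div_convexComb_le`. -/
theorem dominant_coordinate_bound {n C m M d τ w x v : ℝ} (hn : 1 ≤ n) (hC : 0 < C)
    (hm : 0 < m) (hmM : m ≤ M) (hd : 1 ≤ d) (hτ : 0 < τ) (hτ1 : τ < 1) (hw : 0 ≤ w)
    (hvM : v ≤ M) (hwx : w * x ≤ d) (hwv : C * m ≤ 2 * n * (w * v))
    (hstep : 0 < 1 - (4 * n * M * d / m) * τ)
    (hbig : 64 * (1 - τ) * n ^ 2 * M ^ 2 * d ^ 2 /
      (m ^ 3 * (1 - (4 * n * M * d / m) * τ)) ≤ C) :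
    C * ((1 - τ) * x + τ * v) ≤ w * v := by
  have hn0 : 0 < n := by linarith
  have hM : 0 < M := by linarith
  have hd0 : 0 < d := by linarith
  have h1τ : 0 < 1 - τ := sub_pos.mpr hτ1
  have hwv0 : 0 < w * v := by
    by_contra! h
    nlinarith [mul_pos hC hm]
  have hw0 : 0 < w := lt_of_le_of_ne hw (by rintro rfl; simp at hwv0)
  have hτM : 4 * n * M * τ ≤ m := by
    have h : 4 * n * M * d * τ < m := by
      have h' : 4 * n * M * d / m * τ * m = 4 * n * M * d * τ := by field_simp
      nlinarith [mul_pos hstep hm]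
    have : 4 * n * M * τ * 1 ≤ 4 * n * M * τ * d := by gcongr
    linarith
  have hhalf : C * (τ * v) ≤ w * v / 2 := by
    have h1 : 4 * n * (C * (τ * v)) ≤ C * m := by
      calc 4 * n * (C * (τ * v)) ≤ 4 * n * (C * (τ * M)) := by gcongr
        _ = C * (4 * n * M * τ) := by ring
        _ ≤ C * m := by gcongr
    have h2 : n * (2 * (C * (τ * v))) ≤ n * (w * v) := by linarith
    linarith [le_of_mul_le_mul_left h2 hn0]
  have hlarge : 64 * (1 - τ) * n ^ 2 * M * d ≤ C * m ^ 2 := by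
    rw [div_le_iff₀ (by positivity)] at hbig
    have hle : 1 - (4 * n * M * d / m) * τ ≤ 1 := by
      have : 0 ≤ (4 * n * M * d / m) * τ := by positivity
      linarith
    have h1 : C * (m ^ 3 * (1 - (4 * n * M * d / m) * τ)) ≤ C * (m ^ 3 * 1) := by gcongr
    have h2 : 64 * (1 - τ) * n ^ 2 * (M * m) * (d * 1) ≤
        64 * (1 - τ) * n ^ 2 * (M * M) * (d * d) := by gcongr
    refine le_of_mul_le_mul_right ?_ hm
    linarith
  have hsq : (C * m) ^ 2 ≤ 4 * n ^ 2 * (w * (w * v) * M) := by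
    calc (C * m) ^ 2 ≤ (2 * n * (w * v)) ^ 2 := by gcongr
      _ = 4 * n ^ 2 * (w * (w * v) * v) := by ring
      _ ≤ 4 * n ^ 2 * (w * (w * v) * M) := by gcongr
  have hother : C * ((1 - τ) * x) ≤ w * v / 2 := by
    have h1 : w * (C * ((1 - τ) * x)) ≤ C * ((1 - τ) * d) := by
      calc w * (C * ((1 - τ) * x)) = C * ((1 - τ) * (w * x)) := by ring
        _ ≤ C * ((1 - τ) * d) := by gcongr
    have h2 : 64 * n ^ 2 * M * (C * ((1 - τ) * d)) ≤ 4 * n ^ 2 * (w * (w * v) * M) := by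
      calc 64 * n ^ 2 * M * (C * ((1 - τ) * d)) = C * (64 * (1 - τ) * n ^ 2 * M * d) := by ring
        _ ≤ C * (C * m ^ 2) := by gcongr
        _ = (C * m) ^ 2 := by ring
        _ ≤ _ := hsq
    have h3 : (4 * n ^ 2 * M) * (16 * (C * ((1 - τ) * d))) ≤ (4 * n ^ 2 * M) * (w * (w * v)) := by
      linarith
    have h4 := le_of_mul_le_mul_left h3 (by positivity)
    refine le_of_mul_le_mul_left ?_ hw0
    have : 0 < C * ((1 - τ) * d) := by positivity
    linarith
  linarith

/-- Monotonicity step: under (i) `1 - (4 n μ̄ d_η/μ_) τ_t > 0`,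
(ii) `C_t > 2 d_Ψ d_𝒞/μ_` and (iii) `C_t ≥ κ_t`, one has `C_{t+1} ≤ C_t`. -/
theorem frankWolfe_monotone_step
    (p n : ℕ) (hp : 1 ≤ p) (hn : 1 ≤ n) (c : ℝ) (hc : 0 < c)
    (Ψ : Matrix (Fin p) (Fin p) ℝ) (η : Fin n → ℕ)
    (Φ : Fin n → Matrix (Fin p) (Fin p) ℝ) (hΦ : ∀ i, (Φ i).PosSemidef)
    (α : ℕ → ℝ) (hα : ∀ t, 0 ≤ α t) (hα0 : 0 < α 0)
    (S : ℕ → ℝ) (hS : ∀ t, S t = ∑ k ∈ Finset.range (t + 1), α k)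
    (τ : ℕ → ℝ) (hτ : ∀ t, τ t = α (t + 1) / S (t + 1))
    (hτ01 : ∀ t, 0 < τ t ∧ τ t < 1)
    (G : Matrix (Fin p) (Fin p) ℝ → Matrix (Fin p) (Fin p) ℝ)
    (hG : ∀ Y, G Y = Ψ - ∑ i, ((η i : ℝ) / (((Φ i) * Y).trace)) • Φ i)
    (X V : ℕ → Matrix (Fin p) (Fin p) ℝ)
    (hX0 : (X 0).PosSemidef ∧ (X 0).trace ≤ c)
    (hX0pos : ∀ i, 0 < ((Φ i) * (X 0)).trace)
    (hV : ∀ t, (V t).PosSemidef ∧ (V t).trace ≤ c)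
    (hVmin : ∀ (t : ℕ) (W : Matrix (Fin p) (Fin p) ℝ), W.PosSemidef → W.trace ≤ c →
      ((G (X t)) * (V t)).trace ≤ ((G (X t)) * W).trace)
    (hXsucc : ∀ t, X (t + 1) = (1 - τ t) • X t + τ t • V t)
    (C : ℕ → ℝ) (hC : ∀ t, C t = ∑ i, (η i : ℝ) / (((Φ i) * (X t)).trace))
    (dC dΦ dΨ dη μbar μlow : ℝ)
    (hdC : dC = 2 * c) (hdΦ : dΦ = ⨆ i, specNorm (Φ i)) (hdΨ : dΨ = specNorm Ψ)
    (hdη : dη = ⨆ i, (η i : ℝ))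
    (hμbar : IsGreatest {v : ℝ | ∃ (i : Fin n) (Y : Matrix (Fin p) (Fin p) ℝ),
      Y.PosSemidef ∧ Y.trace ≤ c ∧ v = ((Φ i) * Y).trace} μbar)
    (hμlow : μlow = ⨅ i, ((Φ i) * (X 0)).trace)
    (t : ℕ)
    (h1 : 0 < 1 - (4 * (n : ℝ) * μbar * dη / μlow) * τ t)
    (h2 : C t > 2 * dΨ * dC / μlow)
    (h3 : C t ≥ 64 * (1 - τ t) * (n : ℝ) ^ 2 * μbar ^ 2 * dη ^ 2 /
      (μlow ^ 3 * (1 - (4 * (n : ℝ) * μbar * dη / μlow) * τ t))) :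
    C (t + 1) ≤ C t := by
  have : Nonempty (Fin n) := ⟨⟨0, hn⟩⟩
  have hn' : (1 : ℝ) ≤ n := by exact_mod_cast hn
  obtain ⟨hτ0, hτ1⟩ := hτ01 t
  have hcomb (s : ℕ) (i : Fin n) : (Φ i * X (s + 1)).trace =
      (1 - τ s) * (Φ i * X s).trace + τ s * (Φ i * V s).trace := by
    rw [hXsucc]
    simp [Matrix.mul_add, Matrix.trace_add]
  have hv (s : ℕ) (i : Fin n) : 0 ≤ (Φ i * V s).trace :=
    trace_mul_nonneg_of_posSemidef (hΦ i) (hV s).1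
  have hx (s : ℕ) (i : Fin n) : 0 < (Φ i * X s).trace := by
    induction s with
    | zero => exact hX0pos i
    | succ s ih =>
      rw [hcomb]
      exact add_pos_of_pos_of_nonneg (mul_pos (sub_pos.mpr (hτ01 s).2) ih)
        (mul_nonneg (hτ01 s).1.le (hv s i))
  have hμle (i : Fin n) : μlow ≤ (Φ i * X 0).trace :=
    hμlow ▸ ciInf_le (Set.finite_range _).bddBelow i
  have hμpos : 0 < μlow := by
    obtain ⟨i, hi⟩ := exists_eq_ciInf_of_finite (f := fun i => (Φ i * X 0).trace)
    rw [hμlow, ← hi]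
    exact hX0pos i
  have hle_bar (i : Fin n) (Y : Matrix (Fin p) (Fin p) ℝ) (hY : Y.PosSemidef)
      (hYc : Y.trace ≤ c) : (Φ i * Y).trace ≤ μbar := hμbar.2 ⟨i, Y, hY, hYc, rfl⟩
  have hμμ : μlow ≤ μbar :=
    (hμle ⟨0, hn⟩).trans (hle_bar ⟨0, hn⟩ _ hX0.1 hX0.2)
  have hdη_le (i : Fin n) : (η i : ℝ) ≤ dη :=
    hdη ▸ le_ciSup (f := fun i => (η i : ℝ)) (Set.finite_range _).bddAbove i
  have hdΨ0 : 0 ≤ dΨ := hdΨ ▸ norm_nonneg _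
  have hdC0 : 0 ≤ dC := by linarith
  have hCpos : 0 < C t := lt_of_le_of_lt (by positivity) h2
  have hΨ (W : Matrix (Fin p) (Fin p) ℝ) (hW : W.PosSemidef) (hWc : W.trace ≤ c) :
      |(Ψ * W).trace| ≤ dΨ * c := by
    rw [hdΨ] at hdΨ0 ⊢
    exact (abs_trace_mul_le_specNorm_mul_trace Ψ hW).trans (by gcongr)
  have hGtr (W : Matrix (Fin p) (Fin p) ℝ) : (G (X t) * W).trace =
      (Ψ * W).trace - ∑ i, (η i : ℝ) / (Φ i * X t).trace * (Φ i * W).trace := by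
    rw [hG]
    simp [Matrix.sub_mul, Matrix.sum_mul, Matrix.trace_sub, Matrix.trace_sum]
  have hsum : C t * μlow / 2 ≤
      ∑ i, (η i : ℝ) / (Φ i * X t).trace * (Φ i * V t).trace := by
    have hmin := hVmin t (X 0) hX0.1 hX0.2
    rw [hGtr, hGtr] at hmin
    have hlow : C t * μlow ≤ ∑ i, (η i : ℝ) / (Φ i * X t).trace * (Φ i * X 0).trace := by
      rw [hC, Finset.sum_mul]
      exact Finset.sum_le_sum fun i _ =>
        mul_le_mul_of_nonneg_left (hμle i) (div_nonneg (Nat.cast_nonneg _) (hx t i).le)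
    rw [gt_iff_lt, div_lt_iff₀ hμpos, hdC] at h2
    have hΨV := abs_le.mp (hΨ _ (hV t).1 (hV t).2)
    have hΨX := abs_le.mp (hΨ _ hX0.1 hX0.2)
    linarith [hΨV.1, hΨX.2]
  obtain ⟨j, -, hj⟩ : ∃ j ∈ Finset.univ, C t * μlow / 2 / n ≤
      (η j : ℝ) / (Φ j * X t).trace * (Φ j * V t).trace := by
    refine Finset.exists_le_of_sum_le Finset.univ_nonempty (le_trans (le_of_eq ?_) hsum)
    have : (n : ℝ) ≠ 0 := by positivity
    simp
    field_simp
  have hwv : C t * μlow ≤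
      2 * n * ((η j : ℝ) / (Φ j * X t).trace * (Φ j * V t).trace) := by
    rw [div_le_iff₀ (by positivity)] at hj
    linarith
  have hηj : η j ≠ 0 := by
    intro h
    rw [h] at hwv
    simp only [Nat.cast_zero, zero_div, zero_mul, mul_zero] at hwv
    exact absurd hwv (not_le.mpr (mul_pos hCpos hμpos))
  have hdη1 : 1 ≤ dη :=
    le_trans (by exact_mod_cast Nat.one_le_iff_ne_zero.mpr hηj) (hdη_le j)
  have hdom := dominant_coordinate_bound hn' hCpos hμpos hμμ hdη1 hτ0 hτ1
    (div_nonneg (Nat.cast_nonneg (η j)) (hx t j).le)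
    (hle_bar j _ (hV t).1 (hV t).2)
    (by rw [div_mul_cancel₀ _ (hx t j).ne']; exact hdη_le j) hwv h1 h3
  rw [hC t] at hdom
  rw [hC (t + 1), hC t]
  simp only [hcomb]
  exact sum_div_convexComb_le (fun i => (η i : ℝ)) _ _ (τ t) j (fun _ => Nat.cast_nonneg _)
    (hx t) (hv t) hτ0 hτ1 hdom
end
end

section
/- For every t ≥ 0, the spectral norm of the gradient difference satisfies ‖G(X_{t+1}) − G(X_t)‖ ≤ (τ_t / (1 − τ_t)) · d_Φ² · d_𝒞 · C_t² (the last step uses that each η_i is a natural number, so η_i ≤ η_i²). Since τ_t/(1 − τ_t) = α_{t+1}/S_t, equivalently ‖G(X_{t+1}) − G(X_t)‖ ≤ (α_{t+1}/S_t) · d_Φ² · d_𝒞 · C_t². -/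
noncomputable section

/-- For `Φ` arbitrary and `B` real, `Tr (Φ Bᴴ B)` is the sum of the quadratic form of `Φ` over the
rows of `B`. -/
theorem trace_mul_conjTranspose_mul_self_eq_sum {p : ℕ} (Φ B : Matrix (Fin p) (Fin p) ℝ) :
    (Φ * (B.conjTranspose * B)).trace = ∑ j, B j ⬝ᵥ (Φ.mulVec (B j)) := by
  rw [← Matrix.mul_assoc, Matrix.trace_mul_comm, Matrix.trace]
  simp [Matrix.diag, Matrix.mul_apply, dotProduct, Matrix.mulVec]

open scoped MatrixOrder Matrix.Norms.L2Operator in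
theorem exists_eq_conjTranspose_mul_self_of_posSemidef {p : ℕ} {V : Matrix (Fin p) (Fin p) ℝ}
    (hV : V.PosSemidef) : ∃ B : Matrix (Fin p) (Fin p) ℝ, V = B.conjTranspose * B :=
  CStarAlgebra.nonneg_iff_eq_star_mul_self.mp hV.nonneg

theorem trace_mul_nonneg_of_posSemidef_s12 {p : ℕ} {Φ V : Matrix (Fin p) (Fin p) ℝ}
    (hΦ : Φ.PosSemidef) (hV : V.PosSemidef) : 0 ≤ (Φ * V).trace := by
  obtain ⟨B, rfl⟩ := exists_eq_conjTranspose_mul_self_of_posSemidef hV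
  rw [trace_mul_conjTranspose_mul_self_eq_sum]
  exact Finset.sum_nonneg fun j _ => by simpa using hΦ.dotProduct_mulVec_nonneg (B j)

theorem specNorm_nonneg {p : ℕ} (M : Matrix (Fin p) (Fin p) ℝ) : 0 ≤ specNorm M :=
  norm_nonneg _

theorem dotProduct_mulVec_le_specNorm_mul {p : ℕ} (Φ : Matrix (Fin p) (Fin p) ℝ)
    (x : Fin p → ℝ) : x ⬝ᵥ (Φ.mulVec x) ≤ specNorm Φ * (x ⬝ᵥ x) := by
  set y : EuclideanSpace ℝ (Fin p) := WithLp.toLp 2 x with hy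
  have h1 : x ⬝ᵥ (Φ.mulVec x) = inner ℝ y (Matrix.toEuclideanCLM (𝕜 := ℝ) Φ y) := by
    rw [hy, Matrix.toEuclideanCLM_toLp, EuclideanSpace.inner_toLp_toLp]
    simp [dotProduct_comm]
  have h2 : x ⬝ᵥ x = ‖y‖ * ‖y‖ := by
    rw [← real_inner_self_eq_norm_mul_norm, hy, EuclideanSpace.inner_toLp_toLp]
    simp
  rw [h1, h2]
  calc inner ℝ y (Matrix.toEuclideanCLM (𝕜 := ℝ) Φ y)
      ≤ ‖y‖ * ‖Matrix.toEuclideanCLM (𝕜 := ℝ) Φ y‖ := real_inner_le_norm _ _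
    _ ≤ ‖y‖ * (specNorm Φ * ‖y‖) := by
        gcongr
        exact ContinuousLinearMap.le_opNorm _ _
    _ = specNorm Φ * (‖y‖ * ‖y‖) := by ring

theorem trace_mul_le_specNorm_mul_trace_s12 {p : ℕ} (Φ : Matrix (Fin p) (Fin p) ℝ)
    {V : Matrix (Fin p) (Fin p) ℝ} (hV : V.PosSemidef) :
    (Φ * V).trace ≤ specNorm Φ * V.trace := by
  obtain ⟨B, rfl⟩ := exists_eq_conjTranspose_mul_self_of_posSemidef hV
  have h := trace_mul_conjTranspose_mul_self_eq_sum 1 B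
  simp only [Matrix.one_mul, Matrix.one_mulVec] at h
  rw [trace_mul_conjTranspose_mul_self_eq_sum, h, Finset.mul_sum]
  exact Finset.sum_le_sum fun j _ => dotProduct_mulVec_le_specNorm_mul Φ (B j)

theorem specNorm_sum_smul_le {p : ℕ} {ι : Type*} (s : Finset ι) (a : ι → ℝ)
    (Φ : ι → Matrix (Fin p) (Fin p) ℝ) :
    specNorm (∑ i ∈ s, a i • Φ i) ≤ ∑ i ∈ s, |a i| * specNorm (Φ i) := by
  unfold specNorm
  rw [map_sum]
  refine (norm_sum_le _ _).trans (Finset.sum_le_sum fun i _ => ?_)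
  rw [map_smul, norm_smul, Real.norm_eq_abs]

/-- Change of `1 / a` under a convex step from `a > 0` towards `v ≥ 0`. -/
theorem abs_div_sub_div_convex_step_le {a v m τ η : ℝ} (ha : 0 < a) (hv : 0 ≤ v) (ham : a ≤ m)
    (hvm : v ≤ m) (hτ : 0 < τ) (hτ1 : τ < 1) (hη : 0 ≤ η) :
    |η / a - η / ((1 - τ) * a + τ * v)| ≤ τ / (1 - τ) * m * (η / a ^ 2) := by
  have h1 : 0 < 1 - τ := sub_pos.mpr hτ1
  have hb : 0 < (1 - τ) * a + τ * v := by positivity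
  have hm : 0 ≤ m := hv.trans hvm
  have hva : |v - a| ≤ m := abs_le.mpr ⟨by linarith, by linarith⟩
  have e : η / a - η / ((1 - τ) * a + τ * v)
      = η * τ * (v - a) / (a * ((1 - τ) * a + τ * v)) := by
    field_simp
    ring
  rw [e, abs_div, abs_mul, abs_of_nonneg (by positivity : 0 ≤ η * τ),
    abs_of_pos (mul_pos ha hb)]
  calc η * τ * |v - a| / (a * ((1 - τ) * a + τ * v))
      ≤ η * τ * m / (a * ((1 - τ) * a)) := by
        gcongr
        exact le_add_of_nonneg_right (by positivity)
    _ = τ / (1 - τ) * m * (η / a ^ 2) := by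
        field_simp

theorem sum_natCast_div_sq_le_sq_sum {ι : Type*} (s : Finset ι) (η : ι → ℕ) {a : ι → ℝ}
    (ha : ∀ i ∈ s, 0 < a i) :
    ∑ i ∈ s, (η i : ℝ) / a i ^ 2 ≤ (∑ i ∈ s, (η i : ℝ) / a i) ^ 2 := by
  calc ∑ i ∈ s, (η i : ℝ) / a i ^ 2 ≤ ∑ i ∈ s, ((η i : ℝ) / a i) ^ 2 := by
        refine Finset.sum_le_sum fun i _ => ?_
        rw [div_pow]
        gcongr
        exact_mod_cast Nat.le_self_pow two_ne_zero (η i)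
    _ ≤ (∑ i ∈ s, (η i : ℝ) / a i) ^ 2 :=
        Finset.sum_sq_le_sq_sum_of_nonneg fun i hi => div_nonneg (Nat.cast_nonneg _) (ha i hi).le

/-- Bound on the gradient difference in spectral norm:
`‖G(X_{t+1}) - G(X_t)‖ ≤ (τ_t/(1-τ_t)) d_Φ² d_𝒞 C_t² = (α_{t+1}/S_t) d_Φ² d_𝒞 C_t²`. -/
theorem frankWolfe_gradient_diff_bound
    (p n : ℕ) (hp : 1 ≤ p) (hn : 1 ≤ n) (c : ℝ) (hc : 0 < c)
    (Ψ : Matrix (Fin p) (Fin p) ℝ) (η : Fin n → ℕ)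
    (Φ : Fin n → Matrix (Fin p) (Fin p) ℝ) (hΦ : ∀ i, (Φ i).PosSemidef)
    (α : ℕ → ℝ) (hα : ∀ t, 0 ≤ α t) (hα0 : 0 < α 0)
    (S : ℕ → ℝ) (hS : ∀ t, S t = ∑ k ∈ Finset.range (t + 1), α k)
    (τ : ℕ → ℝ) (hτ : ∀ t, τ t = α (t + 1) / S (t + 1))
    (hτ01 : ∀ t, 0 < τ t ∧ τ t < 1)
    (G : Matrix (Fin p) (Fin p) ℝ → Matrix (Fin p) (Fin p) ℝ)
    (hG : ∀ Y, G Y = Ψ - ∑ i, ((η i : ℝ) / (((Φ i) * Y).trace)) • Φ i)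
    (X V : ℕ → Matrix (Fin p) (Fin p) ℝ)
    (hX0 : (X 0).PosSemidef ∧ (X 0).trace ≤ c)
    (hX0pos : ∀ i, 0 < ((Φ i) * (X 0)).trace)
    (hV : ∀ t, (V t).PosSemidef ∧ (V t).trace ≤ c)
    (hVmin : ∀ (t : ℕ) (W : Matrix (Fin p) (Fin p) ℝ), W.PosSemidef → W.trace ≤ c →
      ((G (X t)) * (V t)).trace ≤ ((G (X t)) * W).trace)
    (hXsucc : ∀ t, X (t + 1) = (1 - τ t) • X t + τ t • V t)
    (C : ℕ → ℝ) (hC : ∀ t, C t = ∑ i, (η i : ℝ) / (((Φ i) * (X t)).trace))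
    (dC dΦ dΨ dη μbar μlow : ℝ)
    (hdC : dC = 2 * c) (hdΦ : dΦ = ⨆ i, specNorm (Φ i)) (hdΨ : dΨ = specNorm Ψ)
    (hdη : dη = ⨆ i, (η i : ℝ))
    (hμbar : IsGreatest {v : ℝ | ∃ (i : Fin n) (Y : Matrix (Fin p) (Fin p) ℝ),
      Y.PosSemidef ∧ Y.trace ≤ c ∧ v = ((Φ i) * Y).trace} μbar)
    (hμlow : μlow = ⨅ i, ((Φ i) * (X 0)).trace)
    :
    ∀ t : ℕ,
      specNorm (G (X (t + 1)) - G (X t)) ≤ (τ t / (1 - τ t)) * dΦ ^ 2 * dC * (C t) ^ 2 ∧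
      specNorm (G (X (t + 1)) - G (X t)) ≤ (α (t + 1) / S t) * dΦ ^ 2 * dC * (C t) ^ 2 := by
  intro t
  have hX : ∀ t, ((X t).PosSemidef ∧ (X t).trace ≤ c) ∧ ∀ i, 0 < (Φ i * X t).trace := by
    intro t
    induction t with
    | zero => exact ⟨hX0, hX0pos⟩
    | succ t ih =>
      obtain ⟨⟨hpsd, htr⟩, hpos⟩ := ih
      obtain ⟨h0, h1⟩ := hτ01 t
      have h1' : 0 < 1 - τ t := sub_pos.mpr h1
      refine ⟨⟨?_, ?_⟩, fun i => ?_⟩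
      · rw [hXsucc]
        exact (hpsd.smul h1'.le).add ((hV t).1.smul h0.le)
      · rw [hXsucc, Matrix.trace_add, Matrix.trace_smul, Matrix.trace_smul, smul_eq_mul,
          smul_eq_mul]
        nlinarith [mul_le_mul_of_nonneg_left htr h1'.le, mul_le_mul_of_nonneg_left (hV t).2 h0.le]
      · have hv := trace_mul_nonneg_of_posSemidef_s12 (hΦ i) (hV t).1
        have ha := hpos i
        rw [hXsucc, Matrix.mul_add, Matrix.mul_smul, Matrix.mul_smul, Matrix.trace_add,
          Matrix.trace_smul, Matrix.trace_smul, smul_eq_mul, smul_eq_mul]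
        positivity
  obtain ⟨h0, h1⟩ := hτ01 t
  have h1' : 0 < 1 - τ t := sub_pos.mpr h1
  have hratio : τ t / (1 - τ t) = α (t + 1) / S t := by
    have hSt : 0 < S t := by
      rw [hS]
      exact Finset.sum_pos' (fun k _ => hα k) ⟨0, by simp, hα0⟩
    have hSs : S (t + 1) = S t + α (t + 1) := by rw [hS, hS, Finset.sum_range_succ]
    have hSt' : 0 < S t + α (t + 1) := add_pos_of_pos_of_nonneg hSt (hα _)
    have e : 1 - τ t = S t / (S t + α (t + 1)) := by
      rw [hτ, hSs]
      field_simp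
      ring
    rw [e, hτ, hSs]
    field_simp
  rw [← hratio, and_self]
  have hle : ∀ i, specNorm (Φ i) ≤ dΦ := fun i => by
    rw [hdΦ]
    exact le_ciSup (f := fun i => specNorm (Φ i)) (Set.finite_range _).bddAbove i
  have hdΦ0 : 0 ≤ dΦ := (specNorm_nonneg _).trans (hle ⟨0, hn⟩)
  have hbd : ∀ (i : Fin n) (Y : Matrix (Fin p) (Fin p) ℝ), Y.PosSemidef → Y.trace ≤ c →
      (Φ i * Y).trace ≤ dΦ * dC := by
    intro i Y hY hYc
    refine (trace_mul_le_specNorm_mul_trace_s12 (Φ i) hY).trans ?_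
    exact mul_le_mul (hle i) (by linarith) hY.trace_nonneg hdΦ0
  have hdiff : G (X (t + 1)) - G (X t) = ∑ i, ((η i : ℝ) / (Φ i * X t).trace -
      (η i : ℝ) / ((1 - τ t) * (Φ i * X t).trace + τ t * (Φ i * V t).trace)) • Φ i := by
    rw [hG, hG, sub_sub_sub_cancel_left, ← Finset.sum_sub_distrib]
    refine Finset.sum_congr rfl fun i _ => ?_
    rw [← sub_smul, hXsucc, Matrix.mul_add, Matrix.mul_smul, Matrix.mul_smul, Matrix.trace_add,
      Matrix.trace_smul, Matrix.trace_smul, smul_eq_mul, smul_eq_mul]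
  obtain ⟨⟨hpsd, htr⟩, hpos⟩ := hX t
  have hdC0 : 0 ≤ dC := by rw [hdC]; positivity
  rw [hdiff]
  calc _ ≤ _ := specNorm_sum_smul_le _ _ _
    _ ≤ ∑ i, (τ t / (1 - τ t) * (dΦ * dC) * ((η i : ℝ) / (Φ i * X t).trace ^ 2)) * dΦ := by
        refine Finset.sum_le_sum fun i _ => ?_
        have hstep := abs_div_sub_div_convex_step_le (hpos i)
          (trace_mul_nonneg_of_posSemidef_s12 (hΦ i) (hV t).1) (hbd i _ hpsd htr)
          (hbd i _ (hV t).1 (hV t).2) h0 h1 (Nat.cast_nonneg (η i))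
        exact mul_le_mul hstep (hle i) (specNorm_nonneg _) ((abs_nonneg _).trans hstep)
    _ = τ t / (1 - τ t) * dΦ ^ 2 * dC * ∑ i, (η i : ℝ) / (Φ i * X t).trace ^ 2 := by
        rw [Finset.mul_sum]
        exact Finset.sum_congr rfl fun i _ => by ring
    _ ≤ τ t / (1 - τ t) * dΦ ^ 2 * dC * C t ^ 2 := by
        rw [hC]
        gcongr
        exact sum_natCast_div_sq_le_sq_sum _ _ fun i _ => hpos i
end
end

section
/- For every t ≥ 0 and every X ∈ 𝒞, S_t · g(X_t) ≤ Σ_{k=0}^t α_k · [ g(X_k) + Tr( G(X_k) (X − X_k) ) ] + B_t. -/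
noncomputable section

open scoped MatrixOrder Matrix.Norms.L2Operator in
/-- The trace of a product of two positive semidefinite matrices is nonnegative. -/
theorem trace_mul_nonneg_of_posSemidef_s13 {m : Type*} [Fintype m] [DecidableEq m]
    {A W : Matrix m m ℝ} (hA : A.PosSemidef) (hW : W.PosSemidef) : 0 ≤ (A * W).trace := by
  obtain ⟨B, rfl⟩ := CStarAlgebra.nonneg_iff_eq_star_mul_self.mp hW.nonneg
  rw [Matrix.star_eq_conjTranspose, ← Matrix.mul_assoc, Matrix.trace_mul_comm, ← Matrix.mul_assoc]
  exact (hA.mul_mul_conjTranspose_same B).trace_nonneg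

/-- A symmetric matrix is dominated by its spectral norm in the Loewner order. -/
theorem posSemidef_specNorm_smul_one_sub {p : ℕ} {A : Matrix (Fin p) (Fin p) ℝ}
    (hA : A.IsHermitian) : (specNorm A • (1 : Matrix (Fin p) (Fin p) ℝ) - A).PosSemidef := by
  refine Matrix.PosSemidef.of_dotProduct_mulVec_nonneg ?_ fun x => ?_
  · exact (Matrix.isHermitian_one.smul (IsSelfAdjoint.all _)).sub hA
  · set y : EuclideanSpace ℝ (Fin p) := WithLp.toLp 2 x
    have hquad := Matrix.inner_toEuclideanCLM A y y
    have hcs := real_inner_le_norm y (Matrix.toEuclideanCLM (𝕜 := ℝ) A y)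
    have hop := (Matrix.toEuclideanCLM (𝕜 := ℝ) A).le_opNorm y
    have hnorm : ‖y‖ * ‖y‖ = x ⬝ᵥ x := by
      rw [← real_inner_self_eq_norm_mul_norm, EuclideanSpace.inner_eq_star_dotProduct]
      simp [y]
    have hmul := mul_le_mul_of_nonneg_left hop (norm_nonneg y)
    have hle : x ⬝ᵥ A.mulVec x ≤ specNorm A * (x ⬝ᵥ x) := by
      rw [← hnorm]
      unfold specNorm
      change inner ℝ y _ = x ⬝ᵥ A.mulVec x at hquad
      linarith
    simpa [Matrix.sub_mulVec, Matrix.smul_mulVec, dotProduct_sub, dotProduct_smul] using hle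

theorem trace_mul_le_specNorm_mul_trace_s13 {p : ℕ} {A W : Matrix (Fin p) (Fin p) ℝ}
    (hA : A.IsHermitian) (hW : W.PosSemidef) : (A * W).trace ≤ specNorm A * W.trace := by
  have h := trace_mul_nonneg_of_posSemidef_s13 (posSemidef_specNorm_smul_one_sub hA) hW
  simpa [Matrix.sub_mul, Matrix.trace_sub, Matrix.trace_smul] using h

/-- The tangent-line bound for the logarithm, a form of its concavity. -/
theorem Real.log_le_log_add_div {a b : ℝ} (ha : 0 < a) (hb : 0 < b) :
    Real.log a ≤ Real.log b + (a - b) / b := by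
  have h := Real.log_le_sub_one_of_pos (div_pos ha hb)
  rw [Real.log_div ha.ne' hb.ne'] at h
  have : (a - b) / b = a / b - 1 := by field_simp
  linarith

/-- Weighted form of the relative smoothness of `-log`: if `b` is a step of relative length `s`
from `a` towards `v`, the reciprocals change by at most a multiple of `(w / a) ^ 2`. -/
theorem weighted_inv_sub_inv_mul_le {w : ℕ} {a v b y s D : ℝ} (ha : 0 < a) (haD : a ≤ D)
    (hv : 0 ≤ v) (hvD : v ≤ D) (hy : 0 ≤ y) (hyD : y ≤ D) (hs : 0 < s) (hs1 : s < 1)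
    (hb : b = (1 - s) * a + s * v) :
    (w / b - w / a) * (y - v) ≤ s / (1 - s) * ((w / a) ^ 2 * D ^ 2) := by
  have h1s : 0 < 1 - s := by linarith
  have hab : (1 - s) * a ≤ b := by nlinarith
  have hbpos : 0 < b := lt_of_lt_of_le (mul_pos h1s ha) hab
  have hw : (w : ℝ) ≤ (w : ℝ) ^ 2 := by exact_mod_cast Nat.le_self_pow two_ne_zero w
  have hprod : (a - v) * (y - v) ≤ D ^ 2 := by
    refine (le_abs_self _).trans ?_
    rw [abs_mul, sq]
    gcongr
    · linarith
    · exact abs_le.mpr ⟨by linarith, by linarith⟩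
    · exact abs_le.mpr ⟨by linarith, by linarith⟩
  have heq : (w / b - w / a) * (y - v) = w * s * ((a - v) * (y - v)) / (a * b) := by
    have : a - b = s * (a - v) := by rw [hb]; ring
    field_simp
    rw [this]
    ring
  calc (w / b - w / a) * (y - v) = w * s * ((a - v) * (y - v)) / (a * b) := heq
    _ ≤ w * s * D ^ 2 / (a * b) := by gcongr
    _ ≤ w ^ 2 * s * D ^ 2 / (a * ((1 - s) * a)) := by gcongr
    _ = s / (1 - s) * ((w / a) ^ 2 * D ^ 2) := by field_simp

theorem trace_sub_sum_smul_mul {m ι : Type*} [Fintype m] [Fintype ι] (Ψ : Matrix m m ℝ)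
    (r : ι → ℝ) (Φ : ι → Matrix m m ℝ) (W : Matrix m m ℝ) :
    ((Ψ - ∑ i, r i • Φ i) * W).trace = (Ψ * W).trace - ∑ i, r i * (Φ i * W).trace := by
  simp [Matrix.sub_mul, Matrix.trace_sub, Finset.sum_mul, Matrix.trace_sum, Matrix.trace_smul]

/-- Nesterov-style estimate-sequence bound: for every `t` and every `X ∈ 𝒞`,
`S_t g(X_t) ≤ ∑_{k≤t} α_k [g(X_k) + Tr(G(X_k)(X - X_k))] + B_t`. -/
theorem frankWolfe_nesterov_bound
    (p n : ℕ) (hp : 1 ≤ p) (hn : 1 ≤ n) (c : ℝ) (hc : 0 < c)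
    (Ψ : Matrix (Fin p) (Fin p) ℝ) (η : Fin n → ℕ)
    (Φ : Fin n → Matrix (Fin p) (Fin p) ℝ) (hΦ : ∀ i, (Φ i).PosSemidef)
    (α : ℕ → ℝ) (hα : ∀ t, 0 ≤ α t) (hα0 : 0 < α 0)
    (S : ℕ → ℝ) (hS : ∀ t, S t = ∑ k ∈ Finset.range (t + 1), α k)
    (τ : ℕ → ℝ) (hτ : ∀ t, τ t = α (t + 1) / S (t + 1))
    (hτ01 : ∀ t, 0 < τ t ∧ τ t < 1)
    (G : Matrix (Fin p) (Fin p) ℝ → Matrix (Fin p) (Fin p) ℝ)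
    (hG : ∀ Y, G Y = Ψ - ∑ i, ((η i : ℝ) / (((Φ i) * Y).trace)) • Φ i)
    (X V : ℕ → Matrix (Fin p) (Fin p) ℝ)
    (hX0 : (X 0).PosSemidef ∧ (X 0).trace ≤ c)
    (hX0pos : ∀ i, 0 < ((Φ i) * (X 0)).trace)
    (hV : ∀ t, (V t).PosSemidef ∧ (V t).trace ≤ c)
    (hVmin : ∀ (t : ℕ) (W : Matrix (Fin p) (Fin p) ℝ), W.PosSemidef → W.trace ≤ c →
      ((G (X t)) * (V t)).trace ≤ ((G (X t)) * W).trace)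
    (hXsucc : ∀ t, X (t + 1) = (1 - τ t) • X t + τ t • V t)
    (C : ℕ → ℝ) (hC : ∀ t, C t = ∑ i, (η i : ℝ) / (((Φ i) * (X t)).trace))
    (g : Matrix (Fin p) (Fin p) ℝ → ℝ)
    (hg : ∀ Y, g Y = (Ψ * Y).trace - ∑ i, (η i : ℝ) * Real.log (((Φ i) * Y).trace))
    (dC dΦ : ℝ) (hdC : dC = 2 * c) (hdΦ : dΦ = ⨆ i, specNorm (Φ i))
    (Cbar : ℝ) (hCbar : ∀ t : ℕ, C t ≤ Cbar)
    (γ : ℝ) (hγ : γ = Cbar ^ 2 * dΦ ^ 2 * dC ^ 2)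
    (mx : ℝ) (hmx : IsGreatest {v : ℝ | ∃ Y : Matrix (Fin p) (Fin p) ℝ,
      Y.PosSemidef ∧ Y.trace ≤ c ∧ v = ((G (X 0)) * (X 0 - Y)).trace} mx)
    (B : ℕ → ℝ)
    (hB : ∀ t : ℕ, B t = α 0 * mx + (∑ k ∈ Finset.Icc 1 t, (α k) ^ 2 / S (k - 1)) * γ)
    :
    ∀ (t : ℕ) (Y : Matrix (Fin p) (Fin p) ℝ), Y.PosSemidef → Y.trace ≤ c →
      S t * g (X t) ≤
        (∑ k ∈ Finset.range (t + 1), α k * (g (X k) + ((G (X k)) * (Y - X k)).trace)) + B t := by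
  have hmem : ∀ t, (X t).PosSemidef ∧ (X t).trace ≤ c := by
    intro t
    induction t with
    | zero => exact hX0
    | succ t ih =>
      obtain ⟨h0, h1⟩ := hτ01 t
      rw [hXsucc]
      refine ⟨(ih.1.smul (by linarith)).add ((hV t).1.smul h0.le), ?_⟩
      rw [Matrix.trace_add, Matrix.trace_smul, Matrix.trace_smul, smul_eq_mul, smul_eq_mul]
      nlinarith [ih.2, (hV t).2]
  have htr : ∀ t i, (Φ i * X (t + 1)).trace =
      (1 - τ t) * (Φ i * X t).trace + τ t * (Φ i * V t).trace := by
    intro t i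
    rw [hXsucc]
    simp [Matrix.mul_add, Matrix.trace_add, Matrix.trace_smul]
  have hpos : ∀ t i, 0 < (Φ i * X t).trace := by
    intro t i
    induction t with
    | zero => exact hX0pos i
    | succ t ih =>
      obtain ⟨h0, h1⟩ := hτ01 t
      have hVi := trace_mul_nonneg_of_posSemidef_s13 (hΦ i) (hV t).1
      rw [htr]
      have := mul_pos (sub_pos.mpr h1) ih
      positivity
  have hD : ∀ i W, W.PosSemidef → W.trace ≤ c → (Φ i * W).trace ≤ dΦ * dC := by
    intro i W hW hWc
    have hspec : specNorm (Φ i) ≤ dΦ :=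
      hdΦ ▸ le_ciSup (f := fun i => specNorm (Φ i)) (Set.finite_range _).bddAbove i
    have hspec0 : 0 ≤ specNorm (Φ i) := norm_nonneg _
    have hW0 : 0 ≤ W.trace := hW.trace_nonneg
    calc (Φ i * W).trace ≤ specNorm (Φ i) * W.trace :=
          trace_mul_le_specNorm_mul_trace_s13 (hΦ i).isHermitian hW
      _ ≤ dΦ * dC := by
        have hWd : W.trace ≤ dC := by linarith
        exact mul_le_mul hspec hWd hW0 (hspec0.trans hspec)
  have hSpos : ∀ t, 0 < S t := fun t => by
    rw [hS, Finset.sum_range_succ']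
    have := Finset.sum_nonneg fun k (_ : k ∈ Finset.range t) => hα (k + 1)
    positivity
  have hSsucc : ∀ t, S (t + 1) = S t + α (t + 1) := fun t => by
    rw [hS, hS, Finset.sum_range_succ]
  have hconv : ∀ t, g (X (t + 1)) + (G (X (t + 1)) * (X t - X (t + 1))).trace ≤ g (X t) := by
    intro t
    have hlog : ∑ i, (η i : ℝ) * Real.log (Φ i * X t).trace ≤
        ∑ i, ((η i : ℝ) * Real.log (Φ i * X (t + 1)).trace +
          η i / (Φ i * X (t + 1)).trace * (Φ i * (X t - X (t + 1))).trace) := by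
      gcongr with i
      have h := Real.log_le_log_add_div (hpos t i) (hpos (t + 1) i)
      rw [Matrix.mul_sub, Matrix.trace_sub]
      calc _ ≤ (η i : ℝ) * _ := mul_le_mul_of_nonneg_left h (Nat.cast_nonneg _)
        _ = _ := by ring
    rw [hg, hg, hG, trace_sub_sum_smul_mul, Matrix.mul_sub, Matrix.trace_sub]
    rw [Finset.sum_add_distrib] at hlog
    linarith
  have hgrad : ∀ t (Y : Matrix (Fin p) (Fin p) ℝ), Y.PosSemidef → Y.trace ≤ c →
      -(τ t / (1 - τ t) * γ) ≤ (G (X (t + 1)) * (Y - V t)).trace := by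
    intro t Y hY hYc
    obtain ⟨h0, h1⟩ := hτ01 t
    have h1τ : 0 < 1 - τ t := by linarith
    have hmin := hVmin t Y hY hYc
    have hC0 : ∀ i, 0 ≤ (η i : ℝ) / (Φ i * X t).trace := fun i =>
      div_nonneg (Nat.cast_nonneg _) (hpos t i).le
    have hCsq : ∑ i, ((η i : ℝ) / (Φ i * X t).trace) ^ 2 ≤ Cbar ^ 2 := by
      refine (Finset.sum_sq_le_sq_sum_of_nonneg fun i _ => hC0 i).trans ?_
      rw [← hC]
      have : 0 ≤ C t := hC t ▸ Finset.sum_nonneg fun i _ => hC0 i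
      have := hCbar t
      gcongr
    have hsum : ∑ i, ((η i : ℝ) / (Φ i * X (t + 1)).trace - η i / (Φ i * X t).trace) *
        (Φ i * (Y - V t)).trace ≤ τ t / (1 - τ t) * γ := by
      calc _ ≤ ∑ i, τ t / (1 - τ t) *
            (((η i : ℝ) / (Φ i * X t).trace) ^ 2 * (dΦ * dC) ^ 2) := by
            refine Finset.sum_le_sum fun i _ => ?_
            rw [Matrix.mul_sub, Matrix.trace_sub]
            exact weighted_inv_sub_inv_mul_le (hpos t i) (hD i _ (hmem t).1 (hmem t).2)
              (trace_mul_nonneg_of_posSemidef_s13 (hΦ i) (hV t).1) (hD i _ (hV t).1 (hV t).2)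
              (trace_mul_nonneg_of_posSemidef_s13 (hΦ i) hY) (hD i _ hY hYc) h0 h1 (htr t i)
        _ = τ t / (1 - τ t) *
            ((∑ i, ((η i : ℝ) / (Φ i * X t).trace) ^ 2) * (dΦ * dC) ^ 2) := by
            rw [← Finset.mul_sum, ← Finset.sum_mul]
        _ ≤ τ t / (1 - τ t) * (Cbar ^ 2 * (dΦ * dC) ^ 2) := by gcongr
        _ = τ t / (1 - τ t) * γ := by rw [hγ]; ring
    have hdiff : (G (X (t + 1)) * (Y - V t)).trace = (G (X t) * (Y - V t)).trace -
        ∑ i, ((η i : ℝ) / (Φ i * X (t + 1)).trace - η i / (Φ i * X t).trace) *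
          (Φ i * (Y - V t)).trace := by
      rw [hG, hG, trace_sub_sum_smul_mul, trace_sub_sum_smul_mul]
      simp only [sub_mul, Finset.sum_sub_distrib]
      ring
    have hopt : 0 ≤ (G (X t) * (Y - V t)).trace := by
      rw [Matrix.mul_sub, Matrix.trace_sub]
      linarith
    linarith
  intro t
  induction t with
  | zero =>
    intro Y hY hYc
    have hgap : (G (X 0) * (X 0 - Y)).trace ≤ mx := hmx.2 ⟨Y, hY, hYc, rfl⟩
    have := mul_le_mul_of_nonneg_left hgap hα0.le
    rw [Matrix.mul_sub, Matrix.trace_sub] at this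
    simp only [hS, hB, Matrix.mul_sub, Matrix.trace_sub, zero_add, Finset.sum_range_one,
      Finset.Icc_eq_empty_of_lt zero_lt_one, Finset.sum_empty, zero_mul, add_zero]
    linarith
  | succ t ih =>
    intro Y hY hYc
    have hSt := hSpos t
    have hSt1 := hSpos (t + 1)
    have hratio : τ t / (1 - τ t) = α (t + 1) / S t := by
      have : 1 - τ t = S t / S (t + 1) := by
        rw [hτ, hSsucc]
        rw [hSsucc] at hSt1
        field_simp
        ring
      rw [this, hτ]
      field_simp
    have hBsucc : B (t + 1) = B t + α (t + 1) ^ 2 / S t * γ := by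
      rw [hB, hB, Finset.sum_Icc_succ_top (by omega), Nat.add_sub_cancel]
      ring
    have hcomb : S t • (X t - X (t + 1)) + α (t + 1) • (Y - X (t + 1)) =
        α (t + 1) • (Y - V t) := by
      have hmul : S (t + 1) • X (t + 1) = S t • X t + α (t + 1) • V t := by
        have hατ : S (t + 1) * τ t = α (t + 1) := by rw [hτ]; field_simp
        rw [hXsucc, smul_add, smul_smul, smul_smul, mul_sub, mul_one, hατ, hSsucc,
          add_sub_cancel_right]
      rw [hSsucc, add_smul] at hmul
      linear_combination (norm := module) -hmul
    have hlin : S t * (G (X (t + 1)) * (X t - X (t + 1))).trace +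
        α (t + 1) * (G (X (t + 1)) * (Y - X (t + 1))).trace =
        α (t + 1) * (G (X (t + 1)) * (Y - V t)).trace := by
      simpa [Matrix.mul_add, Matrix.trace_add, Matrix.trace_smul] using
        congrArg (fun M => (G (X (t + 1)) * M).trace) hcomb
    have hstep := mul_le_mul_of_nonneg_left (hgrad t Y hY hYc) (hα (t + 1))
    have hc' := mul_le_mul_of_nonneg_left (hconv t) hSt.le
    have hγ' : α (t + 1) * -(α (t + 1) / S t * γ) = -(α (t + 1) ^ 2 / S t * γ) := by ring
    rw [hratio, hγ'] at hstep
    rw [Finset.sum_range_succ, hBsucc, hSsucc]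
    linarith [ih Y hY hYc]
end
end
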